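/- Let β ∈ ℝ, γ ≥ 0, ρ a probability measure on ℝ (arbitrary if γ = 0), and t ≥ 0. Let ν = δ_β ⊎ Φ[ρ]^{⊎γ} be the probability measure with z − F_ν(z) = β + γ·G_ρ(z). Then B_t[ν] = δ_β ⊎ Φ[ρ ⊞ δ_{βt} ⊞ σ^{⊞γt}]^{⊎γ}; explicitly, z − F_{B_t[ν]}(z) = β + γ·G_{ρ ⊞ δ_{βt} ⊞ σ_{0,γt}}(z) on ℂ⁺. -/

import Mathlib

open MeasureTheory Complex

noncomputable section

/-- The Cauchy transform `G_μ(z) = ∫ 1/(z - x) dμ(x)` of a measure on `ℝ`. -/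
def cauchyG (μ : Measure ℝ) (z : ℂ) : ℂ := ∫ x : ℝ, (z - (x : ℂ))⁻¹ ∂μ

/-- The F-transform `F_μ = 1/G_μ`. -/
def Ftr (μ : Measure ℝ) (z : ℂ) : ℂ := (cauchyG μ z)⁻¹

/-- The open upper half-plane `ℂ⁺`. -/
def UHP : Set ℂ := {z : ℂ | 0 < z.im}

/-- The truncated cone `Γ_{α,M} = {z ∈ ℂ⁺ : |Re z| < α · Im z, Im z > M}`. -/
def tcone (α M : ℝ) : Set ℂ := {z : ℂ | |z.re| < α * z.im ∧ M < z.im}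

/-- `φ` is a Voiculescu transform of `μ`: `φ(F_μ(z)) + F_μ(z) = z` on some truncated cone. -/
def IsVT (μ : Measure ℝ) (φ : ℂ → ℂ) : Prop :=
  ∃ α M : ℝ, 0 < α ∧ 0 < M ∧ ∀ z ∈ tcone α M, φ (Ftr μ z) + Ftr μ z = z

/-- `ψ` is a two-state Voiculescu transform of the pair `(μt, μ)`:
`ψ(F_μ(z)) + F_{μt}(z) = z` on some truncated cone. -/
def IsTwoStateVT (μt μ : Measure ℝ) (ψ : ℂ → ℂ) : Prop :=
  ∃ α M : ℝ, 0 < α ∧ 0 < M ∧ ∀ z ∈ tcone α M, ψ (Ftr μ z) + Ftr μt z = z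

/-- `μ` is freely infinitely divisible: some Voiculescu transform `φ` of `μ` is such that
`t·φ` is a Voiculescu transform of a probability measure for every `t ≥ 0`. -/
def IsFID (μ : Measure ℝ) : Prop :=
  ∃ φ : ℂ → ℂ, IsVT μ φ ∧ ∀ t : ℝ, 0 ≤ t →
    ∃ ν : Measure ℝ, IsProbabilityMeasure ν ∧ IsVT ν (fun z => (t : ℂ) * φ z)

/-- The semicircular distribution with mean `β` and variance `γ` (Dirac mass at `β` for `γ = 0`). -/
def semicircle (β γ : ℝ) : Measure ℝ :=
  if γ = 0 then Measure.dirac β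
  else volume.withDensity
    (fun x => ENNReal.ofReal ((2 * Real.pi * γ)⁻¹ * Real.sqrt (4 * γ - (x - β) ^ 2)))

open Filter Topology Metric

theorem isOpen_UHP : IsOpen UHP := isOpen_lt continuous_const Complex.continuous_im

theorem sub_ofReal_ne_zero {z : ℂ} (hz : z ∈ UHP) (x : ℝ) : z - (x : ℂ) ≠ 0 := by
  intro h
  have h' : z.im = 0 := by simpa using congrArg Complex.im h
  exact (ne_of_gt hz) h'

theorem im_le_norm_sub_ofReal (z : ℂ) (x : ℝ) : z.im ≤ ‖z - (x : ℂ)‖ := by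
  simpa using (le_abs_self _).trans (Complex.abs_im_le_norm (z - (x : ℂ)))

theorem norm_inv_sub_ofReal_le {z : ℂ} (hz : z ∈ UHP) (x : ℝ) :
    ‖(z - (x : ℂ))⁻¹‖ ≤ z.im⁻¹ := by
  rw [norm_inv]
  exact inv_anti₀ hz (im_le_norm_sub_ofReal z x)

theorem integrable_inv_sub_ofReal (μ : Measure ℝ) [IsFiniteMeasure μ] {z : ℂ} (hz : z ∈ UHP) :
    Integrable (fun x : ℝ => (z - (x : ℂ))⁻¹) μ :=
  Integrable.of_bound (by fun_prop) z.im⁻¹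
    (Eventually.of_forall fun x => norm_inv_sub_ofReal_le hz x)

theorem cauchyG_eq_neg_resolventTransform (μ : Measure ℝ) (z : ℂ) :
    cauchyG μ z = -resolventTransform μ z := by
  rw [cauchyG, resolventTransform_apply, ← integral_neg]
  congr 1
  ext x
  rw [resolvent, Ring.inverse_eq_inv', ← inv_neg, neg_sub]
  rfl

theorem differentiableOn_cauchyG (μ : Measure ℝ) [IsFiniteMeasure μ] :
    DifferentiableOn ℂ (cauchyG μ) UHP := by
  intro z hz
  have hmem : z ∉ algebraMap ℝ ℂ '' μ.support := by
    rintro ⟨x, -, rfl⟩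
    exact (lt_irrefl (0 : ℝ)) (by simp [UHP] at hz)
  have h := (hasDerivAt_resolventTransform (μ := μ) z hmem).neg
  refine (h.differentiableAt.congr_of_eventuallyEq ?_).differentiableWithinAt
  exact Eventually.of_forall (cauchyG_eq_neg_resolventTransform μ)

theorem cauchyG_im_neg (μ : Measure ℝ) [IsProbabilityMeasure μ] {z : ℂ} (hz : z ∈ UHP) :
    (cauchyG μ z).im < 0 := by
  have hint := integrable_inv_sub_ofReal μ hz
  have him : (cauchyG μ z).im = -∫ x : ℝ, -((z - (x : ℂ))⁻¹).im ∂μ := by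
    rw [integral_neg, neg_neg]
    exact (integral_im hint).symm
  have hpos : ∀ x : ℝ, 0 < -((z - (x : ℂ))⁻¹).im := by
    intro x
    have hz' : 0 < z.im := hz
    have hn := Complex.normSq_pos.2 (sub_ofReal_ne_zero hz x)
    rw [Complex.inv_im]
    simp only [sub_im, ofReal_im, sub_zero, neg_div, neg_neg]
    positivity
  rw [him, neg_lt_zero, integral_pos_iff_support_of_nonneg (fun x => (hpos x).le) hint.im.neg]
  have hs : (Function.support fun x : ℝ => -((z - (x : ℂ))⁻¹).im) = Set.univ :=
    Set.eq_univ_of_forall fun x => (hpos x).ne'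
  rw [hs]
  simp

theorem differentiableOn_Ftr (μ : Measure ℝ) [IsProbabilityMeasure μ] :
    DifferentiableOn ℂ (Ftr μ) UHP :=
  (differentiableOn_cauchyG μ).inv fun z hz h => by
    have := cauchyG_im_neg μ hz
    simp [h] at this

/-- `f` is asymptotically the identity at infinity in the cone `{|Re z| < Im z}`. -/
def AsympId (f : ℂ → ℂ) : Prop :=
  ∀ ε : ℝ, 0 < ε → ∃ M : ℝ, 0 < M ∧ ∀ z ∈ tcone 1 M, ‖f z - z‖ ≤ ε * z.im

theorem norm_le_two_mul_im {z : ℂ} (h : |z.re| ≤ z.im) : ‖z‖ ≤ 2 * z.im := by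
  have h0 : 0 ≤ z.im := (abs_nonneg _).trans h
  have := Complex.norm_le_abs_re_add_abs_im z
  rw [abs_of_nonneg h0] at this
  linarith

theorem asympId_Ftr (μ : Measure ℝ) [IsProbabilityMeasure μ] : AsympId (Ftr μ) := by
  set K : Filter ℂ := comap Complex.im atTop ⊓ 𝓟 {z | |z.re| ≤ z.im}
  have him : Tendsto Complex.im K atTop := tendsto_comap.mono_left inf_le_left
  have hcone : ∀ᶠ z in K, |z.re| ≤ z.im := mem_inf_of_right (mem_principal_self _)
  have hUHP : ∀ᶠ z in K, z ∈ UHP := him.eventually_gt_atTop 0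
  have hlim : Tendsto (fun z : ℂ => ∫ x : ℝ, z * (z - (x : ℂ))⁻¹ ∂μ) K
      (𝓝 (∫ _ : ℝ, (1 : ℂ) ∂μ)) := by
    refine tendsto_integral_filter_of_dominated_convergence (fun _ => 2)
      (Eventually.of_forall fun z => by fun_prop) ?_ (integrable_const _)
      (Eventually.of_forall fun x => ?_)
    · filter_upwards [hcone, hUHP] with z h1 h2
      refine Eventually.of_forall fun x => ?_
      have h3 : 0 < z.im := h2
      calc ‖z * (z - (x : ℂ))⁻¹‖ = ‖z‖ * ‖(z - (x : ℂ))⁻¹‖ := norm_mul _ _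
        _ ≤ 2 * z.im * z.im⁻¹ := by
            gcongr
            · exact norm_le_two_mul_im h1
            · exact norm_inv_sub_ofReal_le h2 x
        _ = 2 := by field_simp
    · rw [tendsto_iff_norm_sub_tendsto_zero]
      have h0 : Tendsto (fun z : ℂ => |x| * z.im⁻¹) K (𝓝 0) := by
        simpa using (tendsto_inv_atTop_zero.comp him).const_mul |x|
      refine squeeze_zero' (Eventually.of_forall fun z => norm_nonneg _) ?_ h0
      filter_upwards [hUHP] with z h2
      have h3 := sub_ofReal_ne_zero h2 x
      have h4 : z * (z - (x : ℂ))⁻¹ - 1 = x * (z - (x : ℂ))⁻¹ := by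
        field_simp
        ring
      rw [h4, norm_mul, Complex.norm_real, Real.norm_eq_abs]
      gcongr
      exact norm_inv_sub_ofReal_le h2 x
  have hlim1 : Tendsto (fun z : ℂ => ‖(z * cauchyG μ z)⁻¹ - 1‖) K (𝓝 0) := by
    rw [← tendsto_iff_norm_sub_tendsto_zero]
    simp only [integral_const_mul, integral_const, probReal_univ, one_smul] at hlim
    simpa [cauchyG] using hlim.inv₀ one_ne_zero
  intro ε hε
  have hev : ∀ᶠ z in K, ‖Ftr μ z - z‖ ≤ ε * z.im := by
    filter_upwards [hlim1.eventually_lt_const (half_pos hε), hcone, hUHP] with z h1 h2 h3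
    have h3' : 0 < z.im := h3
    have hz : z ≠ 0 := by
      rintro rfl
      simp at h3'
    have h4 : Ftr μ z - z = z * ((z * cauchyG μ z)⁻¹ - 1) := by
      rw [Ftr, mul_inv, mul_sub, ← mul_assoc, mul_inv_cancel₀ hz]
      ring
    rw [h4, norm_mul]
    calc ‖z‖ * ‖(z * cauchyG μ z)⁻¹ - 1‖ ≤ 2 * z.im * (ε / 2) := by
          gcongr
          exact norm_le_two_mul_im h2
      _ = ε * z.im := by ring
  obtain ⟨A, hA, hAK⟩ := mem_comap.1 (mem_inf_principal.1 hev)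
  obtain ⟨N, hN⟩ := mem_atTop_sets.1 hA
  refine ⟨max N 1, by positivity, fun z hz => ?_⟩
  obtain ⟨h1, h2⟩ := hz
  exact hAK (hN _ ((le_max_left _ _).trans h2.le)) (by simpa using h1.le)

/-- The filter generated by the truncated cones. -/
def coneFilter : Filter ℂ where
  sets := {S | ∃ α M : ℝ, 0 < α ∧ 0 < M ∧ tcone α M ⊆ S}
  univ_sets := ⟨1, 1, one_pos, one_pos, Set.subset_univ _⟩
  sets_of_superset := by
    rintro S T ⟨α, M, hα, hM, h⟩ hST
    exact ⟨α, M, hα, hM, h.trans hST⟩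
  inter_sets := by
    rintro S T ⟨α, M, hα, hM, h⟩ ⟨α', M', hα', hM', h'⟩
    refine ⟨min α α', max M M', lt_min hα hα', lt_max_of_lt_left hM, fun z hz => ?_⟩
    obtain ⟨h1, h2⟩ := hz
    have hz0 : 0 ≤ z.im := ((lt_max_of_lt_left hM).trans h2).le
    refine ⟨h ⟨h1.trans_le ?_, (le_max_left _ _).trans_lt h2⟩,
      h' ⟨h1.trans_le ?_, (le_max_right _ _).trans_lt h2⟩⟩
    · exact mul_le_mul_of_nonneg_right (min_le_left _ _) hz0
    · exact mul_le_mul_of_nonneg_right (min_le_right _ _) hz0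

theorem mem_coneFilter {S : Set ℂ} :
    S ∈ coneFilter ↔ ∃ α M : ℝ, 0 < α ∧ 0 < M ∧ tcone α M ⊆ S := Iff.rfl

theorem isVT_iff_eventually {μ : Measure ℝ} {φ : ℂ → ℂ} :
    IsVT μ φ ↔ ∀ᶠ z in coneFilter, φ (Ftr μ z) + Ftr μ z = z := Iff.rfl

theorem eventually_mem_UHP : ∀ᶠ z in coneFilter, z ∈ UHP :=
  ⟨1, 1, one_pos, one_pos, fun _ hz => one_pos.trans hz.2⟩

theorem AsympId.tendsto {f : ℂ → ℂ} (hf : AsympId f) : Tendsto f coneFilter coneFilter := by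
  rintro S ⟨α, M, hα, hM, hS⟩
  set a := min α 1
  have ha : 0 < a := lt_min hα one_pos
  have ha1 : a ≤ 1 := min_le_right _ _
  have haα : a ≤ α := min_le_left _ _
  obtain ⟨M', hM', hf'⟩ := hf (a / 4) (by positivity)
  refine ⟨a / 4, max M' (2 * M), by positivity, by positivity, fun z hz => hS ?_⟩
  obtain ⟨h1, h2⟩ := hz
  obtain ⟨h3, h4⟩ := max_lt_iff.1 h2
  have hy : 0 < z.im := hM'.trans h3
  have h5 := hf' z ⟨by nlinarith, h3⟩
  have h6 := (Complex.abs_re_le_norm _).trans h5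
  have h7 := (Complex.abs_im_le_norm _).trans h5
  simp only [sub_re, sub_im] at h6 h7
  have h8 : |(f z).re| ≤ |z.re| + |(f z).re - z.re| := by
    have := abs_add_le z.re ((f z).re - z.re)
    simpa using this
  have h9 := (abs_le.1 h7).1
  have h10 : 3 / 4 * z.im ≤ (f z).im := by nlinarith
  constructor
  · nlinarith
  · linarith

theorem AsympId.le_map {f : ℂ → ℂ} (hf : AsympId f) (hd : DifferentiableOn ℂ f UHP) :
    coneFilter ≤ map f coneFilter := by
  intro S hS
  obtain ⟨α, M, hα, hM, hS⟩ := mem_coneFilter.1 (mem_map.1 hS)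
  set a := min α 1
  have ha : 0 < a := lt_min hα one_pos
  have ha1 : a ≤ 1 := min_le_right _ _
  have haα : a ≤ α := min_le_left _ _
  obtain ⟨M', hM', hf'⟩ := hf (a / 32) (by positivity)
  refine ⟨a / 4, 2 * max M' M, by positivity, by positivity, fun w hw => ?_⟩
  obtain ⟨h1, h2⟩ := hw
  have h3 : 2 * M' < w.im := lt_of_le_of_lt (by gcongr; exact le_max_left _ _) h2
  have h4 : 2 * M < w.im := lt_of_le_of_lt (by gcongr; exact le_max_right _ _) h2
  have hy : 0 < w.im := by linarith
  set r := a / 4 * w.im with hr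
  have hr0 : 0 < r := by positivity
  have hball : ∀ z ∈ closedBall w r, |z.re| < a * z.im ∧ 3 / 4 * w.im ≤ z.im ∧
      z.im ≤ 5 / 4 * w.im := by
    intro z hz
    have hz' : ‖z - w‖ ≤ r := by simpa [dist_eq_norm] using hz
    have h6 := (Complex.abs_re_le_norm _).trans hz'
    have h7 := (Complex.abs_im_le_norm _).trans hz'
    simp only [sub_re, sub_im] at h6 h7
    have h8 : |z.re| ≤ |w.re| + |z.re - w.re| := by
      have := abs_add_le w.re (z.re - w.re)
      simpa using this
    have h9 := abs_le.1 h7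
    have h10 : r ≤ 1 / 4 * w.im := by rw [hr]; gcongr
    have h11 : 3 / 4 * w.im ≤ z.im := by linarith
    refine ⟨?_, h11, by linarith⟩
    nlinarith
  have hUHP : closedBall w r ⊆ UHP := fun z hz => by
    have := (hball z hz).2.1
    show 0 < z.im
    linarith
  have happrox : ∀ z ∈ closedBall w r, ‖f z - z‖ ≤ a * w.im * (5 / 128) := by
    intro z hz
    obtain ⟨h5, h6, h7⟩ := hball z hz
    have := hf' z ⟨by nlinarith, by linarith⟩
    nlinarith
  have hww : w ∈ closedBall w r := mem_closedBall_self hr0.le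
  have hsphere : ∀ z ∈ sphere w r, a * w.im * (3 / 16 - 1 / 64) ≤ ‖f z - f w‖ := by
    intro z hz
    have h5 := happrox z (sphere_subset_closedBall hz)
    have h6 := happrox w hww
    have h7 : ‖z - w‖ = r := by simpa [dist_eq_norm] using hz
    have h8 : z - w = (f z - f w) - (f z - z) + (f w - w) := by ring
    have h9 : ‖z - w‖ ≤ ‖f z - f w‖ + ‖f z - z‖ + ‖f w - w‖ := by
      conv_lhs => rw [h8]
      exact (norm_add_le _ _).trans (by gcongr; exact norm_sub_le _ _)
    rw [h7, hr] at h9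
    nlinarith
  have hpos : 0 < a * w.im := by positivity
  have hnonconst : ∃ᶠ z in 𝓝 w, f z ≠ f w := by
    intro hconst
    simp only [not_not] at hconst
    have han : AnalyticOnNhd ℂ f (closedBall w r) :=
      (hd.analyticOnNhd isOpen_UHP).mono hUHP
    have heq := han.eqOn_of_preconnected_of_eventuallyEq (analyticOnNhd_const (v := f w))
      (convex_closedBall w r).isPreconnected hww hconst
    obtain ⟨z, hz⟩ := (NormedSpace.sphere_nonempty (x := w) (r := r)).2 hr0.le
    have h5 := hsphere z hz
    rw [heq (sphere_subset_closedBall hz)] at h5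
    simp only [sub_self, norm_zero] at h5
    linarith
  have hdcl : DiffContOnCl ℂ f (ball w r) :=
    DifferentiableOn.diffContOnCl (by
      rw [closure_ball w hr0.ne']
      exact hd.mono hUHP)
  have hmem : w ∈ ball (f w) (a * w.im * (3 / 16 - 1 / 64) / 2) := by
    rw [mem_ball, dist_comm, dist_eq_norm]
    have := happrox w hww
    linarith
  obtain ⟨z, hz, hfz⟩ := hdcl.ball_subset_image_closedBall hr0 hsphere hnonconst hmem
  rw [← hfz]
  refine hS ⟨?_, ?_⟩
  · have := hball z hz
    nlinarith
  · have := hball z hz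
    linarith

theorem norm_mul_exp_mul_I_lt_one {q : ℂ} (hq : ‖q‖ < 1) (θ : ℝ) :
    ‖q * Complex.exp (θ * I)‖ < 1 := by
  rwa [norm_mul, Complex.norm_exp_ofReal_mul_I, mul_one]

theorem one_sub_ne_zero_of_norm_lt_one {w : ℂ} (hw : ‖w‖ < 1) : 1 - w ≠ 0 := by
  intro h
  rw [← sub_eq_zero.1 h] at hw
  simp at hw

theorem continuous_inv_one_sub_mul_exp {q : ℂ} (hq : ‖q‖ < 1) :
    Continuous fun θ : ℝ => (1 - q * Complex.exp (θ * I))⁻¹ :=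
  Continuous.inv₀ (by fun_prop) fun θ =>
    one_sub_ne_zero_of_norm_lt_one (norm_mul_exp_mul_I_lt_one hq θ)

theorem integral_inv_one_sub_mul_exp {q : ℂ} (hq : ‖q‖ < 1) :
    ∫ θ in (0 : ℝ)..2 * Real.pi, (1 - q * Complex.exp (θ * I))⁻¹ = 2 * Real.pi := by
  have hne : ∀ w ∈ closedBall (0 : ℂ) |1|, 1 - q * w ≠ 0 := by
    intro w hw
    have hw' : ‖w‖ ≤ 1 := by simpa using hw
    refine one_sub_ne_zero_of_norm_lt_one ?_
    rw [norm_mul]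
    nlinarith [norm_nonneg w, norm_nonneg q]
  have hd : DiffContOnCl ℂ (fun w : ℂ => (1 - q * w)⁻¹) (ball 0 |1|) := by
    refine DifferentiableOn.diffContOnCl ?_
    rw [closure_ball _ (by simp)]
    exact DifferentiableOn.inv (by fun_prop) hne
  have h := hd.circleAverage
  rw [Real.circleAverage_def] at h
  simp only [circleMap, ofReal_one, one_mul, zero_add, mul_zero, sub_zero, inv_one,
    Complex.real_smul] at h
  have hpi : ((2 * Real.pi : ℝ) : ℂ) ≠ 0 := by
    exact_mod_cast (by positivity : (2 * Real.pi : ℝ) ≠ 0)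
  rw [ofReal_inv, inv_mul_eq_one₀ hpi] at h
  rw [← h]
  push_cast
  rfl

theorem one_sub_two_mul_cos_add_sq (q : ℂ) (θ : ℝ) :
    1 - 2 * q * Complex.cos θ + q ^ 2 =
      (1 - q * Complex.exp (θ * I)) * (1 - q * Complex.exp (-θ * I)) := by
  have h : Complex.exp (θ * I) * Complex.exp (-θ * I) = 1 := by
    rw [← Complex.exp_add]
    simp
  rw [Complex.cos]
  linear_combination (-q ^ 2) * h

theorem one_sub_two_mul_cos_add_sq_ne_zero {q : ℂ} (hq : ‖q‖ < 1) (θ : ℝ) :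
    1 - 2 * q * Complex.cos θ + q ^ 2 ≠ 0 := by
  rw [one_sub_two_mul_cos_add_sq]
  refine mul_ne_zero (one_sub_ne_zero_of_norm_lt_one (norm_mul_exp_mul_I_lt_one hq θ)) ?_
  have := norm_mul_exp_mul_I_lt_one hq (-θ)
  push_cast at this
  exact one_sub_ne_zero_of_norm_lt_one this

theorem integral_sin_sq_div {q : ℂ} (hq : ‖q‖ < 1) (hq0 : q ≠ 0) :
    ∫ θ in (0 : ℝ)..Real.pi, Complex.sin θ ^ 2 / (1 - 2 * q * Complex.cos θ + q ^ 2) =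
      (Real.pi : ℂ) / 2 := by
  set A : ℝ → ℂ := fun θ => (1 - q * Complex.exp (θ * I))⁻¹ with hA
  have hAc : Continuous A := continuous_inv_one_sub_mul_exp hq
  have hsub : ∫ θ in (0 : ℝ)..Real.pi, A (2 * Real.pi - θ) =
      ∫ θ in Real.pi..2 * Real.pi, A θ := by
    rw [intervalIntegral.integral_comp_sub_left]
    congr 1 <;> ring
  have hsum : (∫ θ in (0 : ℝ)..Real.pi, A θ) + ∫ θ in (0 : ℝ)..Real.pi, A (2 * Real.pi - θ) =
      2 * Real.pi := by
    rw [hsub, intervalIntegral.integral_add_adjacent_intervals (hAc.intervalIntegrable _ _)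
      (hAc.intervalIntegrable _ _)]
    exact integral_inv_one_sub_mul_exp hq
  have hcos : ∫ θ in (0 : ℝ)..Real.pi, Complex.cos θ = 0 := by
    have := integral_cos (a := 0) (b := Real.pi)
    simp only [Real.sin_pi, Real.sin_zero, sub_zero] at this
    rw [← ofReal_zero, ← this, ← intervalIntegral.integral_ofReal]
    simp
  have hpt : ∀ θ : ℝ, Complex.sin θ ^ 2 / (1 - 2 * q * Complex.cos θ + q ^ 2) =
      -(1 - q ^ 2) / (4 * q ^ 2) * (A θ + A (2 * Real.pi - θ)) +
        ((1 - q ^ 2) / (4 * q ^ 2) + (1 + q ^ 2) / (4 * q ^ 2) + 1 / (2 * q) * Complex.cos θ) := by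
    intro θ
    have hB : A (2 * Real.pi - θ) = (1 - q * Complex.exp (-θ * I))⁻¹ := by
      rw [hA]
      have : ((2 * Real.pi - θ : ℝ) : ℂ) * I = -θ * I + 2 * Real.pi * I := by
        push_cast
        ring
      simp only [this, Complex.exp_add, Complex.exp_two_pi_mul_I, mul_one]
    have hD := one_sub_two_mul_cos_add_sq_ne_zero hq θ
    have hfac := one_sub_two_mul_cos_add_sq q θ
    have hAB := hD
    rw [hfac] at hAB
    have hA0 := left_ne_zero_of_mul hAB
    have hB0 := right_ne_zero_of_mul hAB
    have hsumAB : A θ + A (2 * Real.pi - θ) =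
        (2 - 2 * q * Complex.cos θ) / (1 - 2 * q * Complex.cos θ + q ^ 2) := by
      rw [hB, eq_div_iff hD, hfac]
      simp only [hA, Complex.cos]
      generalize Complex.exp (θ * I) = E at *
      generalize Complex.exp (-θ * I) = E' at *
      rw [inv_add_inv hA0 hB0, div_mul_cancel₀ _ hAB]
      ring
    have hsin : Complex.sin θ ^ 2 = 1 - Complex.cos θ ^ 2 := by
      rw [← Complex.sin_sq_add_cos_sq (θ : ℂ)]
      ring
    rw [hsumAB, hsin]
    obtain ⟨D, hDdef⟩ : ∃ D, D = 1 - 2 * q * Complex.cos θ + q ^ 2 := ⟨_, rfl⟩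
    have hcosD : Complex.cos θ = (1 + q ^ 2 - D) / (2 * q) := by
      rw [hDdef]
      field_simp
      ring
    rw [← hDdef] at hD ⊢
    rw [hcosD]
    field_simp
    ring
  rw [intervalIntegral.integral_congr fun θ _ => hpt θ]
  have hBc : Continuous fun θ : ℝ => A (2 * Real.pi - θ) := by fun_prop
  have hcosc : Continuous fun θ : ℝ => Complex.cos θ := by fun_prop
  rw [intervalIntegral.integral_add (Continuous.intervalIntegrable (by fun_prop) _ _)
    (Continuous.intervalIntegrable (by fun_prop) _ _), intervalIntegral.integral_const_mul,
    intervalIntegral.integral_add (hAc.intervalIntegrable _ _) (hBc.intervalIntegrable _ _), hsum,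
    intervalIntegral.integral_add (Continuous.intervalIntegrable (by fun_prop) _ _)
    (Continuous.intervalIntegrable (by fun_prop) _ _), intervalIntegral.integral_const_mul, hcos]
  simp only [intervalIntegral.integral_const, sub_zero, Complex.real_smul, mul_zero, add_zero]
  field_simp
  ring

theorem cauchyG_semicircle_eq_intervalIntegral {s : ℝ} (hs : 0 < s) (z : ℂ) :
    cauchyG (semicircle 0 s) z = ∫ x in (-(2 * √s))..(2 * √s),
      (((2 * Real.pi * s)⁻¹ * √(4 * s - x ^ 2) : ℝ) : ℂ) * (z - (x : ℂ))⁻¹ := by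
  have hs' : √s ^ 2 = s := Real.sq_sqrt hs.le
  have hs0 : 0 < √s := Real.sqrt_pos.2 hs
  rw [cauchyG, semicircle, if_neg hs.ne', integral_withDensity_eq_integral_toReal_smul
    (by fun_prop) (Eventually.of_forall fun x => ENNReal.ofReal_lt_top)]
  rw [intervalIntegral.integral_of_le (by linarith), ← integral_Icc_eq_integral_Ioc]
  rw [setIntegral_eq_integral_of_forall_compl_eq_zero]
  · congr 1
    ext x
    rw [ENNReal.toReal_ofReal (by positivity), Complex.real_smul, sub_zero]
  · intro x hx
    have : 4 * s - x ^ 2 ≤ 0 := by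
      by_contra! h
      refine hx (abs_le.1 (abs_le_of_sq_le_sq ?_ (by positivity)))
      nlinarith
    rw [Real.sqrt_eq_zero_of_nonpos this]
    simp

theorem cauchyG_semicircle {s : ℝ} (hs : 0 < s) {v : ℂ} (hv : √s < ‖v‖) :
    cauchyG (semicircle 0 s) (v + s / v) = v⁻¹ := by
  have hs' : √s ^ 2 = s := Real.sq_sqrt hs.le
  have hs0 : 0 < √s := Real.sqrt_pos.2 hs
  have hsc : (√s : ℂ) ≠ 0 := by exact_mod_cast hs0.ne'
  have hsc' : (s : ℂ) = (√s : ℂ) ^ 2 := by exact_mod_cast hs'.symm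
  have hv0 : v ≠ 0 := norm_pos_iff.1 (hs0.trans hv)
  set q : ℂ := √s / v with hq
  have hq0 : q ≠ 0 := div_ne_zero hsc hv0
  have hq1 : ‖q‖ < 1 := by
    rw [hq, norm_div, Complex.norm_real, Real.norm_of_nonneg hs0.le]
    exact (div_lt_one (hs0.trans hv)).2 hv
  have hz : ∀ θ : ℝ, v + s / v - ((2 * √s * Real.cos θ : ℝ) : ℂ) =
      v * (1 - 2 * q * Complex.cos θ + q ^ 2) := by
    intro θ
    rw [hq, hsc']
    push_cast
    field_simp
    ring
  rw [cauchyG_semicircle_eq_intervalIntegral hs]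
  set g : ℝ → ℂ := fun x =>
    (((2 * Real.pi * s)⁻¹ * √(4 * s - x ^ 2) : ℝ) : ℂ) * (v + s / v - (x : ℂ))⁻¹ with hg
  set f : ℝ → ℝ := fun θ => 2 * √s * Real.cos θ with hf
  set f' : ℝ → ℝ := fun θ => 2 * √s * -Real.sin θ with hf'
  have hgc : ContinuousOn g (f '' Set.uIcc 0 Real.pi) := by
    refine ContinuousOn.mul (by fun_prop) (ContinuousOn.inv₀ (by fun_prop) ?_)
    rintro _ ⟨θ, -, rfl⟩
    rw [hf, hz θ]
    exact mul_ne_zero hv0 (one_sub_two_mul_cos_add_sq_ne_zero hq1 θ)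
  have hsubst := intervalIntegral.integral_deriv_smul_comp' (f := f) (f' := f') (g := g)
    (a := 0) (b := Real.pi) (fun θ _ => (Real.hasDerivAt_cos θ).const_mul (2 * √s))
    (by fun_prop) hgc
  have hpt : ∀ θ ∈ Set.uIcc 0 Real.pi, f' θ • (g ∘ f) θ =
      -(2 / (Real.pi * v)) *
        (Complex.sin θ ^ 2 / (1 - 2 * q * Complex.cos θ + q ^ 2)) := by
    intro θ hθ
    rw [Set.uIcc_of_le Real.pi_pos.le] at hθ
    have hsin := Real.sin_nonneg_of_mem_Icc hθ
    have hsqrt : √(4 * s - (2 * √s * Real.cos θ) ^ 2) = 2 * √s * Real.sin θ := by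
      rw [show 4 * s - (2 * √s * Real.cos θ) ^ 2 = (2 * √s * Real.sin θ) ^ 2 by
        rw [mul_pow, mul_pow, mul_pow, mul_pow, hs', Real.sin_sq]
        ring]
      exact Real.sqrt_sq (by positivity)
    have hD := one_sub_two_mul_cos_add_sq_ne_zero hq1 θ
    have hpi : (Real.pi : ℂ) ≠ 0 := by exact_mod_cast Real.pi_ne_zero
    simp only [Function.comp, hf, hg, hf', hz, hsqrt, Complex.real_smul]
    push_cast
    rw [hsc']
    field_simp
  rw [intervalIntegral.integral_congr hpt, intervalIntegral.integral_const_mul,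
    integral_sin_sq_div hq1 hq0] at hsubst
  simp only [hf, Real.cos_zero, Real.cos_pi, mul_one, mul_neg] at hsubst
  rw [intervalIntegral.integral_symm, ← hsubst]
  have hpi : (Real.pi : ℂ) ≠ 0 := by exact_mod_cast Real.pi_ne_zero
  field_simp

theorem asympId_add_div (s : ℝ) : AsympId fun v => v + s / v := by
  intro ε hε
  refine ⟨max 1 (|s| / ε), by positivity, fun z hz => ?_⟩
  obtain ⟨h1, h2⟩ := max_lt_iff.1 hz.2
  have h3 : z.im ≤ ‖z‖ := (le_abs_self _).trans (Complex.abs_im_le_norm z)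
  rw [add_sub_cancel_left, norm_div, Complex.norm_real, Real.norm_eq_abs,
    div_le_iff₀ (by linarith)]
  rw [div_lt_iff₀ hε] at h2
  nlinarith [mul_pos hε (one_pos.trans h1)]

theorem Ftr_semicircle {s : ℝ} (hs : 0 ≤ s) {v : ℂ} (hv : √s < ‖v‖) :
    Ftr (semicircle 0 s) (v + s / v) = v := by
  rcases hs.eq_or_lt with rfl | hs
  · simp [Ftr, cauchyG, semicircle]
  · rw [Ftr, cauchyG_semicircle hs hv, inv_inv]

/-- Any Voiculescu transform of the centred semicircular distribution of variance `s` is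
`v ↦ s / v` near infinity. -/
theorem IsVT.semicircle_eventually_eq {s : ℝ} (hs : 0 ≤ s) {φ : ℂ → ℂ}
    (hφ : IsVT (semicircle 0 s) φ) : ∀ᶠ v in coneFilter, φ v = s / v := by
  have hlarge : ∀ᶠ v in coneFilter, √s < ‖v‖ := by
    refine ⟨1, max 1 √s, one_pos, by positivity, fun v hv => ?_⟩
    exact ((le_max_right _ _).trans_lt hv.2).trans_le
      ((le_abs_self _).trans (Complex.abs_im_le_norm v))
  filter_upwards [hlarge, (asympId_add_div s).tendsto.eventually (isVT_iff_eventually.1 hφ)]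
    with v h1 h2
  rw [Ftr_semicircle hs h1] at h2
  linear_combination h2

theorem eqOn_UHP_of_eventuallyEq_coneFilter {f g : ℂ → ℂ} (hf : DifferentiableOn ℂ f UHP)
    (hg : DifferentiableOn ℂ g UHP) (hfg : f =ᶠ[coneFilter] g) : Set.EqOn f g UHP := by
  obtain ⟨α, M, hα, hM, h⟩ := mem_coneFilter.1 hfg
  have hopen : IsOpen (tcone α M) :=
    (isOpen_lt Complex.continuous_re.abs (continuous_const.mul Complex.continuous_im)).inter
      (isOpen_lt continuous_const Complex.continuous_im)
  have hmem : ((M + 1 : ℝ) : ℂ) * I ∈ tcone α M := by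
    constructor
    · simp only [re_ofReal_mul, I_re, mul_zero, abs_zero, im_ofReal_mul, I_im, mul_one]
      positivity
    · simp
  have hU : ((M + 1 : ℝ) : ℂ) * I ∈ UHP := hM.trans hmem.2
  exact (hf.analyticOnNhd isOpen_UHP).eqOn_of_preconnected_of_eventuallyEq
    (hg.analyticOnNhd isOpen_UHP) (convex_halfSpace_im_gt 0).isPreconnected hU
    (mem_of_superset (hopen.mem_nhds hmem) h)

/-- For `ν = δ_β ⊎ Φ[ρ]^{⊎γ}` (i.e. `z − F_ν(z) = β + γ G_ρ(z)`),
the Belinschi–Nica transformation `B_t[ν] = (ν^{⊞(1+t)})^{⊎1/(1+t)}` satisfies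
`z − F_{B_t[ν]}(z) = β + γ·G_{ρ ⊞ δ_{βt} ⊞ σ^{⊞γt}}(z)` on `ℂ⁺`. -/
theorem stmt4
    (β γ t : ℝ) (hγ : 0 ≤ γ) (ht : 0 ≤ t)
    (ρ : Measure ℝ) (hρ : IsProbabilityMeasure ρ)
    (ν : Measure ℝ) (hνprob : IsProbabilityMeasure ν)
    (hν : ∀ z ∈ UHP, z - Ftr ν z = (β : ℂ) + (γ : ℂ) * cauchyG ρ z)
    (φν : ℂ → ℂ) (hφν : IsVT ν φν)
    (ν1 : Measure ℝ) (hν1prob : IsProbabilityMeasure ν1)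
    (hν1 : IsVT ν1 (fun z => ((1 + t : ℝ) : ℂ) * φν z))
    (Bt : Measure ℝ) (hBtprob : IsProbabilityMeasure Bt)
    (hBt : ∀ z ∈ UHP, z - Ftr Bt z = ((1 / (1 + t) : ℝ) : ℂ) * (z - Ftr ν1 z))
    (φρ φσ : ℂ → ℂ) (hφρ : IsVT ρ φρ) (hφσ : IsVT (semicircle 0 (γ * t)) φσ)
    (ρt : Measure ℝ) (hρtprob : IsProbabilityMeasure ρt)
    (hρt : IsVT ρt (fun z => φρ z + ((β * t : ℝ) : ℂ) + φσ z)) :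
    ∀ z ∈ UHP, z - Ftr Bt z = (β : ℂ) + (γ : ℂ) * cauchyG ρt z := by
  have hsurj : ∀ᶠ v in coneFilter,
      ∃ z, (φρ (Ftr ρt z) + ((β * t : ℝ) : ℂ) + φσ (Ftr ρt z) + Ftr ρt z = z) ∧
        Ftr ρt z = v := by
    refine (asympId_Ftr ρt).le_map (differentiableOn_Ftr ρt) (mem_map.2 ?_)
    exact (isVT_iff_eventually.1 hρt).mono fun z hz => ⟨z, hz, rfl⟩
  have hσ : ∀ᶠ ω in coneFilter, φσ (Ftr ρ ω) = ((γ * t : ℝ) : ℂ) / Ftr ρ ω :=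
    (asympId_Ftr ρ).tendsto.eventually (hφσ.semicircle_eventually_eq (mul_nonneg hγ ht))
  have hω : ∀ᶠ u in coneFilter, u + ((1 + t : ℝ) : ℂ) * φν u -
      (((1 + t : ℝ) : ℂ) * (β + γ * cauchyG ρt (u + ((1 + t : ℝ) : ℂ) * φν u))) = u := by
    refine (asympId_Ftr ν).le_map (differentiableOn_Ftr ν) (mem_map.2 ?_)
    filter_upwards [(asympId_Ftr ρ).tendsto.eventually hsurj, hσ, isVT_iff_eventually.1 hφν, isVT_iff_eventually.1 hφρ,
      eventually_mem_UHP] with ω ⟨z, hz, hzω⟩ hσω hνω hρω hωU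
    have h1 := hν ω hωU
    rw [hzω, hσω] at hz
    have hG : (Ftr ρ ω)⁻¹ = cauchyG ρ ω := inv_inv _
    have hG' : cauchyG ρt z = cauchyG ρ ω := by
      rw [← hG, ← hzω, Ftr, inv_inv]
    have h2 : φν (Ftr ν ω) = β + γ * cauchyG ρ ω := by linear_combination hνω + h1
    rw [div_eq_mul_inv, hG] at hz
    have h3 : Ftr ν ω + ((1 + t : ℝ) : ℂ) * φν (Ftr ν ω) = z := by
      rw [h2]
      push_cast at hz ⊢
      linear_combination hz - hρω - h1
    show Ftr ν ω + ((1 + t : ℝ) : ℂ) * φν (Ftr ν ω) - _ = Ftr ν ω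
    rw [h3, hG', ← h2, ← h3]
    ring
  have hev : (fun z => z - Ftr ν1 z) =ᶠ[coneFilter]
      fun z => ((1 + t : ℝ) : ℂ) * (β + γ * cauchyG ρt z) := by
    filter_upwards [(asympId_Ftr ν1).tendsto.eventually hω, isVT_iff_eventually.1 hν1]
      with z h1 h2
    have h3 : Ftr ν1 z + ((1 + t : ℝ) : ℂ) * φν (Ftr ν1 z) = z := by linear_combination h2
    rw [h3] at h1
    linear_combination h1
  have heq := eqOn_UHP_of_eventuallyEq_coneFilter
    (differentiableOn_id.sub (differentiableOn_Ftr ν1))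
    (((differentiableOn_cauchyG ρt).const_mul _).const_add _ |>.const_mul _) hev
  intro z hz
  have h1 : z - Ftr ν1 z = ((1 + t : ℝ) : ℂ) * (β + γ * cauchyG ρt z) := heq hz
  rw [hBt z hz, h1, ← mul_assoc, ← ofReal_mul, one_div, inv_mul_cancel₀ (by positivity),
    ofReal_one, one_mul]
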